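/- There is no finite set I ⊂ ℤ with |I| > 3 admitting three second-order invariance structures of pairwise coprime distinct positive degrees; precisely: there do not exist distinct positive integers d₁, d₂, d₃ that are pairwise coprime, together with real polynomials q₁, q₂, q₃, each of degree exactly 2, such that for each i ∈ {1,2,3} and every j ∈ I with q_i(j) ≠ 0 one has j + d_i ∈ I. -/

import Mathlib

open Polynomial

lemma aux_roots (q : Polynomial ℝ) (hq : q.natDegree = 2) (x y z : ℤ) (hxy : y < x) (hyz : z < y) :
    ¬ (Polynomial.eval (x : ℝ) q = 0 ∧ Polynomial.eval (y : ℝ) q = 0 ∧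
      Polynomial.eval (z : ℝ) q = 0) := by
  rintro ⟨hx, hy, hz⟩
  have h1 : (x : ℝ) ≠ y := by exact_mod_cast hxy.ne'
  have h2 : (y : ℝ) ≠ z := by exact_mod_cast hyz.ne'
  have h3 : (x : ℝ) ≠ z := by exact_mod_cast (hyz.trans hxy).ne'
  have hc : ({(x : ℝ), (y : ℝ), (z : ℝ)} : Finset ℝ).card = 3 := Finset.card_eq_three.2
    ⟨_, _, _, h1, h3, h2, rfl⟩
  have := Polynomial.eq_zero_of_natDegree_lt_card_of_eval_eq_zero' q
    ({(x : ℝ), (y : ℝ), (z : ℝ)} : Finset ℝ) (by simp [hx, hy, hz]) (by omega)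
  simp [this] at hq

lemma aux_max (S : Finset ℤ) (h : 0 < S.card) :
    ∃ m ∈ S, (∀ x ∈ S, x ≤ m) ∧ (S.erase m).card = S.card - 1 := by
  have hn := Finset.card_pos.1 h
  exact ⟨S.max' hn, S.max'_mem hn, fun x hx => S.le_max' x hx,
    Finset.card_erase_of_mem (S.max'_mem hn)⟩

lemma aux_step (I : Finset ℤ) (a b c e : ℤ) (ha : a ∈ I) (hb : b ∈ I) (hc : c ∈ I) (he : e ∈ I)
    (hab : b < a) (hbc : c < b) (hce : e < c)
    (hI : ∀ x ∈ I, e < x → x = a ∨ x = b ∨ x = c) (d : ℕ) (hd : 0 < d) (q : Polynomial ℝ)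
    (hq : q.natDegree = 2)
    (h : ∀ k ∈ I, Polynomial.eval (k : ℝ) q ≠ 0 → k + (d : ℤ) ∈ I) :
    (b + d = a ∧ (c + d = a ∨ c + d = b)) ∨
    (b + d = a ∧ (e + d = a ∨ e + d = b ∨ e + d = c)) ∨
    ((c + d = a ∨ c + d = b) ∧ (e + d = a ∨ e + d = b ∨ e + d = c)) := by
  have key : ∀ k ∈ I, e ≤ k → Polynomial.eval (k : ℝ) q = 0 ∨
      (k + d = a ∨ k + d = b ∨ k + d = c) := by
    intro k hk hek
    by_cases h0 : Polynomial.eval (k : ℝ) q = 0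
    · exact Or.inl h0
    · exact Or.inr (hI _ (h k hk h0) (by omega))
  have h1 := aux_roots q hq a b c hab hbc
  have h2 := aux_roots q hq a b e hab (by omega)
  have h3 := aux_roots q hq a c e (by omega) hce
  have ka : Polynomial.eval (a : ℝ) q = 0 := by
    rcases key a ha (by omega) with h | h
    · exact h
    · omega
  simp only [ka, true_and] at h1 h2 h3
  have kb : Polynomial.eval (b : ℝ) q = 0 ∨ b + d = a := by
    rcases key b hb (by omega) with h | h
    · exact Or.inl h
    · right; omega
  have kc : Polynomial.eval (c : ℝ) q = 0 ∨ (c + d = a ∨ c + d = b) := by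
    rcases key c hc (by omega) with h | h
    · exact Or.inl h
    · right; omega
  have ke := key e he le_rfl
  clear key h hI
  rcases kb with kb | kb
  · rcases kc with kc | kc
    · exact absurd ⟨kb, kc⟩ h1
    · rcases ke with ke | ke
      · exact absurd ⟨kb, ke⟩ h2
      · exact Or.inr (Or.inr ⟨kc, ke⟩)
  · rcases kc with kc | kc
    · rcases ke with ke | ke
      · exact absurd ⟨kc, ke⟩ h3
      · exact Or.inr (Or.inl ⟨kb, ke⟩)
    · exact Or.inl ⟨kb, kc⟩

/-- There is no finite set `I ⊂ ℤ` with `|I| > 3` admitting three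
second-order invariance structures of pairwise coprime distinct positive degrees:
there do not exist distinct, pairwise coprime positive integers `d₁, d₂, d₃` together
with real polynomials `q₁, q₂, q₃`, each of degree exactly `2`, such that for each `i`
and every `j ∈ I` with `qᵢ(j) ≠ 0` one has `j + dᵢ ∈ I`. -/
theorem no_three_coprime_degrees :
    ¬ ∃ (I : Finset ℤ) (d : Fin 3 → ℕ) (q : Fin 3 → Polynomial ℝ),
      3 < I.card ∧
      (∀ i, 0 < d i) ∧
      (∀ i j, i ≠ j → d i ≠ d j) ∧
      (∀ i j, i ≠ j → Nat.Coprime (d i) (d j)) ∧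
      (∀ i, (q i).natDegree = 2) ∧
      (∀ i, ∀ k ∈ I, Polynomial.eval (k : ℝ) (q i) ≠ 0 → k + (d i : ℤ) ∈ I) := by
  rintro ⟨I, d, q, hcard, hpos, hne, -, hq, h⟩
  obtain ⟨a, ha, ha', ca⟩ := aux_max I (by omega)
  obtain ⟨b, hb, hb', cb⟩ := aux_max (I.erase a) (by omega)
  obtain ⟨c, hc, hc', cc⟩ := aux_max ((I.erase a).erase b) (by omega)
  obtain ⟨e, he, he', ce⟩ := aux_max (((I.erase a).erase b).erase c) (by omega)
  simp only [Finset.mem_erase] at hb hb' hc hc' he he'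
  have hab : b < a := lt_of_le_of_ne (ha' b hb.2) hb.1
  have hbc : c < b := lt_of_le_of_ne (hb' c hc.2) hc.1
  have hce : e < c := lt_of_le_of_ne (hc' e he.2) he.1
  have hI : ∀ x ∈ I, e < x → x = a ∨ x = b ∨ x = c := by
    intro x hx hex
    by_contra hcon
    have := he' x ⟨by tauto, by tauto, by tauto, hx⟩
    omega
  have st := fun i => aux_step I a b c e ha hb.2 hc.2.2 he.2.2.2 hab hbc hce hI
    (d i) (hpos i) (q i) (hq i) (h i)
  have s0 := st 0
  have s1 := st 1
  have s2 := st 2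
  have n1 := hne 0 1 (by decide)
  have n2 := hne 0 2 (by decide)
  have n3 := hne 1 2 (by decide)
  clear st ha ha' hb hb' hc hc' he he' h hq hI hne ca cb cc ce hcard
  generalize d 0 = x at *
  generalize d 1 = y at *
  generalize d 2 = z at *
  omega
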